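/- Fix a policy ρ and define ρ̄(q) = sup{ ρ(q',p') : q' ∈ [0,q], p' ∈ [0,v̄] } and ρ̂(q,p) = sup{ ρ(q',p') : q' ∈ [q,1], p' ∈ [0,v̄], q'·p' ≤ q·p }. Let q̲, q ∈ [0,1] with q̲ ≤ q and let p ∈ [0,k_α]. If ρ̂(q,p) ≤ ρ̄(q̲) + (q−q̲)·k_α, then WCR(ρ) ≥ (1−α)·(ρ̄(q̲) + (q−q̲)·k_α) − q·p·log q. -/

import Mathlib

open Real Set MeasureTheory

noncomputable section

/-- `V` is an inverse-demand function: antitone, upper-semicontinuous, with values in `[0, vbar]`. -/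
def IsDemand (vbar : ℝ) (V : ℝ → ℝ) : Prop :=
  AntitoneOn V (Icc 0 1) ∧ UpperSemicontinuousOn V (Icc 0 1) ∧
    ∀ z ∈ Icc (0:ℝ) 1, V z ∈ Icc 0 vbar

/-- `C` is a cost function: monotone increasing, lower-semicontinuous, nonnegative, `C 0 = 0`. -/
def IsCost (C : ℝ → ℝ) : Prop :=
  MonotoneOn C (Icc 0 1) ∧ LowerSemicontinuousOn C (Icc 0 1) ∧
    (∀ z ∈ Icc (0:ℝ) 1, 0 ≤ C z) ∧ C 0 = 0

/-- `(q, p)` is feasible under the inverse-demand function `V`. -/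
def Feasible (vbar : ℝ) (V : ℝ → ℝ) (q p : ℝ) : Prop :=
  q ∈ Icc (0:ℝ) 1 ∧ p ∈ Icc (0:ℝ) vbar ∧ p ≤ V q

/-- The social optimum `OPT(V, C)`. -/
def OPT (V C : ℝ → ℝ) : ℝ :=
  sSup { x | ∃ q ∈ Icc (0:ℝ) 1, x = (∫ z in (0:ℝ)..q, V z) - C q }

/-- `ρ` is a policy: upper-semicontinuous with `ρ 0 0 ≥ 0`. -/
def IsPolicy (vbar : ℝ) (ρ : ℝ → ℝ → ℝ) : Prop :=
  UpperSemicontinuousOn (fun x : ℝ × ℝ => ρ x.1 x.2) (Icc 0 1 ×ˢ Icc 0 vbar) ∧ 0 ≤ ρ 0 0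

/-- `(q, p)` is a firm's best response to `(V, C)` under the policy `ρ`. -/
def BestResponse (vbar : ℝ) (V C : ℝ → ℝ) (ρ : ℝ → ℝ → ℝ) (q p : ℝ) : Prop :=
  Feasible vbar V q p ∧
    ∀ q' p', Feasible vbar V q' p' → ρ q' p' - C q' ≤ ρ q p - C q

/-- The regret `RGRT = DSTR + (1 - α) * FP`. -/
def RGRT (vbar α : ℝ) (V C : ℝ → ℝ) (ρ : ℝ → ℝ → ℝ) (q p : ℝ) : ℝ :=
  (OPT V C - ((∫ z in (0:ℝ)..q, V z) - C q)) + (1 - α) * (ρ q p - C q)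

/-- The worst-case regret of a policy `ρ` (as an extended real, since the supremum
ranges over all demand/cost scenarios and best responses). -/
def WCR (vbar α : ℝ) (ρ : ℝ → ℝ → ℝ) : EReal :=
  sSup { r : EReal | ∃ V C q p, IsDemand vbar V ∧ IsCost C ∧
    BestResponse vbar V C ρ q p ∧ r = ((RGRT vbar α V C ρ q p : ℝ) : EReal) }

/-- The price-cap level `k_α = v̄ / (2 - α)`. -/
def kcap (vbar α : ℝ) : ℝ := vbar / (2 - α)

/-- The objective `min((1-α) q k_α - q p log q, q (k_α - p))`.
(Note `Real.log 0 = 0`, so `q * p * log q` is `0` at `q = 0` as required.) -/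
def regretFn (vbar α q p : ℝ) : ℝ :=
  min ((1 - α) * q * kcap vbar α - q * p * Real.log q) (q * (kcap vbar α - p))

/-- The lower bound `r_α` on the worst-case regret. -/
def rbound (vbar α : ℝ) : ℝ :=
  sSup { x | ∃ q ∈ Icc (0:ℝ) 1, ∃ p ∈ Icc (0:ℝ) (kcap vbar α), x = regretFn vbar α q p }

/-- The subsidy level `s_α`. (`Real.sSup ∅ = 0`, matching the convention for the empty set.) -/
def sbound (vbar α : ℝ) : ℝ :=
  sSup { x | ∃ q ∈ Icc (0:ℝ) 1, ∃ p ∈ Icc (0:ℝ) (kcap vbar α),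
    (1 - α) * q * kcap vbar α - q * p * Real.log q > rbound vbar α ∧
      x = q * (kcap vbar α - p) }


/-- The maximal revenue the firm can get under `ρ` from selling `q` units or less. -/
def rhoBar (vbar : ℝ) (ρ : ℝ → ℝ → ℝ) (q : ℝ) : ℝ :=
  sSup { x | ∃ q' ∈ Icc (0:ℝ) q, ∃ p' ∈ Icc (0:ℝ) vbar, x = ρ q' p' }

/-- The maximal revenue under `ρ` if the firm sells at least `q` units and the marketplace
revenue is at most `q * p`. -/
def rhoHat (vbar : ℝ) (ρ : ℝ → ℝ → ℝ) (q p : ℝ) : ℝ :=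
  sSup { x | ∃ q' ∈ Icc q 1, ∃ p' ∈ Icc (0:ℝ) vbar, q' * p' ≤ q * p ∧ x = ρ q' p' }

/-- The demand equal to `v` up to `q`, and of constant marketplace revenue `q * p` beyond `q`. -/
def truncDemand (v q p z : ℝ) : ℝ := if z ≤ q then v else q * p / z

/-- The cost with marginal cost `k` between `a` and `q`, and zero marginal cost elsewhere. -/
def rampCost (k a q z : ℝ) : ℝ := k * max 0 (min z q - a)

lemma truncDemand_le {v q p z : ℝ} (hq : 0 ≤ q) (hp : 0 ≤ p) (hpv : p ≤ v) :
    truncDemand v q p z ≤ v := by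
  unfold truncDemand
  split_ifs with hz
  · exact le_rfl
  · push Not at hz
    rw [div_le_iff₀ (hq.trans_lt hz)]
    nlinarith

lemma isDemand_truncDemand {v q p : ℝ} (hq : 0 ≤ q) (hp : 0 ≤ p) (hpv : p ≤ v) :
    IsDemand v (truncDemand v q p) := by
  refine ⟨?_, ?_, fun z hz => ⟨?_, truncDemand_le hq hp hpv⟩⟩
  · intro x hx y hy hxy
    by_cases h : x ≤ q
    · simpa only [truncDemand, if_pos h] using truncDemand_le (z := y) hq hp hpv
    · have hy : ¬ y ≤ q := fun h' => h (hxy.trans h')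
      simp only [truncDemand, if_neg h, if_neg hy]
      push Not at h
      exact div_le_div_of_nonneg_left (mul_nonneg hq hp) (hq.trans_lt h) hxy
  · intro x hx
    by_cases h : x ≤ q
    · intro y hy
      simp only [truncDemand, if_pos h] at hy
      exact Filter.Eventually.of_forall fun z => (truncDemand_le hq hp hpv).trans_lt hy
    · push Not at h
      have hev : (fun z => q * p / z) =ᶠ[nhds x] truncDemand v q p := by
        filter_upwards [lt_mem_nhds h] with z hz
        simp [truncDemand, not_le.mpr hz]
      have hc : ContinuousAt (fun z => q * p / z) x :=
        continuousAt_const.div continuousAt_id (hq.trans_lt h).ne'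
      exact (hc.congr hev).continuousWithinAt.upperSemicontinuousWithinAt
  · unfold truncDemand
    split_ifs
    · exact hp.trans hpv
    · exact div_nonneg (mul_nonneg hq hp) hz.1

lemma isCost_rampCost {k a q : ℝ} (hk : 0 ≤ k) (ha : 0 ≤ a) : IsCost (rampCost k a q) := by
  refine ⟨fun x _ y _ hxy => ?_, ?_, fun z _ => mul_nonneg hk (le_max_left _ _), ?_⟩
  · unfold rampCost
    gcongr
  · have : Continuous (rampCost k a q) := by
      unfold rampCost
      fun_prop
    exact this.lowerSemicontinuous.lowerSemicontinuousOn _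
  · have : min 0 q - a ≤ 0 := by linarith [min_le_left 0 q]
    simp [rampCost, max_eq_left this]

lemma IsDemand.intervalIntegrable {v : ℝ} {V : ℝ → ℝ} (hV : IsDemand v V) {a b : ℝ}
    (ha : a ∈ Icc (0 : ℝ) 1) (hb : b ∈ Icc (0 : ℝ) 1) : IntervalIntegrable V volume a b :=
  (hV.1.mono (uIcc_subset_Icc ha hb)).intervalIntegrable

lemma bddAbove_welfare {v : ℝ} {V C : ℝ → ℝ} (hV : IsDemand v V) (hC : IsCost C) :
    BddAbove { x | ∃ q ∈ Icc (0:ℝ) 1, x = (∫ z in (0:ℝ)..q, V z) - C q } := by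
  refine ⟨v, ?_⟩
  rintro _ ⟨q, hq, rfl⟩
  have hv : 0 ≤ v := (hV.2.2 q hq).1.trans (hV.2.2 q hq).2
  have hint : ∫ z in (0:ℝ)..q, V z ≤ ∫ _ in (0:ℝ)..q, v :=
    intervalIntegral.integral_mono_on hq.1 (hV.intervalIntegrable ⟨le_rfl, zero_le_one⟩ hq)
      intervalIntegrable_const fun z hz => (hV.2.2 z ⟨hz.1, hz.2.trans hq.2⟩).2
  rw [intervalIntegral.integral_const, smul_eq_mul] at hint
  nlinarith [hC.2.2.1 q hq, hq.1, hq.2]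

lemma le_OPT {v : ℝ} {V C : ℝ → ℝ} (hV : IsDemand v V) (hC : IsCost C) {q : ℝ}
    (hq : q ∈ Icc (0 : ℝ) 1) : (∫ z in (0:ℝ)..q, V z) - C q ≤ OPT V C :=
  le_csSup (bddAbove_welfare hV hC) ⟨q, hq, rfl⟩

lemma integral_truncDemand_of_le {v q p x : ℝ} (hx : 0 ≤ x) (hxq : x ≤ q) :
    ∫ z in (0:ℝ)..x, truncDemand v q p z = v * x := by
  have : ∫ z in (0:ℝ)..x, truncDemand v q p z = ∫ _ in (0:ℝ)..x, v := by
    refine intervalIntegral.integral_congr fun z hz => ?_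
    rw [uIcc_of_le hx] at hz
    simp [truncDemand, hz.2.trans hxq]
  rw [this, intervalIntegral.integral_const, smul_eq_mul]
  ring

lemma integral_truncDemand {v q p : ℝ} (hq : q ∈ Icc (0 : ℝ) 1) (hp : 0 ≤ p) (hpv : p ≤ v) :
    ∫ z in (0:ℝ)..1, truncDemand v q p z = v * q - q * p * Real.log q := by
  have hV := isDemand_truncDemand hq.1 hp hpv
  rw [← intervalIntegral.integral_add_adjacent_intervals
    (hV.intervalIntegrable ⟨le_rfl, zero_le_one⟩ hq)
    (hV.intervalIntegrable hq ⟨zero_le_one, le_rfl⟩), integral_truncDemand_of_le hq.1 le_rfl]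
  have htail : ∫ z in q..1, truncDemand v q p z = ∫ z in q..1, q * p * z⁻¹ := by
    refine intervalIntegral.integral_congr_ae (Filter.Eventually.of_forall fun z hz => ?_)
    rw [uIoc_of_le hq.2] at hz
    simp [truncDemand, not_le.mpr hz.1, div_eq_mul_inv]
  rw [htail, intervalIntegral.integral_const_mul]
  rcases hq.1.eq_or_lt with rfl | hpos
  · simp
  · rw [integral_inv_of_pos hpos zero_lt_one, one_div, Real.log_inv]
    ring

/-- If some sale of at most `a ≤ q` units is a best response to the truncated demand under the
ramp cost, then its regret includes the forgone surplus on `[a, 1]`. -/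
lemma le_RGRT_truncDemand {v α k a q p x y : ℝ} {ρ : ℝ → ℝ → ℝ} (hq : q ∈ Icc (0 : ℝ) 1)
    (hp : 0 ≤ p) (hpv : p ≤ v) (hk : 0 ≤ k) (hx : 0 ≤ x) (hxa : x ≤ a) (haq : a ≤ q) :
    (v - k) * (q - a) - q * p * Real.log q + (1 - α) * ρ x y ≤
      RGRT v α (truncDemand v q p) (rampCost k a q) ρ x y := by
  have hopt := le_OPT (isDemand_truncDemand hq.1 hp hpv)
    (isCost_rampCost (q := q) hk (hx.trans hxa)) (q := 1) ⟨zero_le_one, le_rfl⟩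
  have hone : rampCost k a q 1 = k * (q - a) := by
    rw [rampCost, min_eq_right hq.2, max_eq_right (sub_nonneg.mpr haq)]
  have hzero : rampCost k a q x = 0 := by
    have : min x q - a ≤ 0 := by linarith [min_le_left x q]
    rw [rampCost, max_eq_left this, mul_zero]
  rw [integral_truncDemand hq hp hpv, hone] at hopt
  rw [RGRT, integral_truncDemand_of_le hx (hxa.trans haq), hzero]
  nlinarith [mul_le_mul_of_nonneg_left hxa (hp.trans hpv)]

/-- Some sale of at most `q` units maximizes the profit when each unit beyond `a` costs `k`. -/
lemma IsPolicy.exists_max_sub_ramp {v a q k : ℝ} {ρ : ℝ → ℝ → ℝ} (hρ : IsPolicy v ρ)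
    (hv : 0 ≤ v) (hq : q ∈ Icc (0 : ℝ) 1) :
    ∃ x ∈ Icc 0 q, ∃ y ∈ Icc 0 v, ∀ x' ∈ Icc 0 q, ∀ y' ∈ Icc 0 v,
      ρ x' y' - k * max 0 (x' - a) ≤ ρ x y - k * max 0 (x - a) := by
  have husc : UpperSemicontinuousOn
      (fun z : ℝ × ℝ => ρ z.1 z.2 + -(k * max 0 (z.1 - a))) (Icc 0 q ×ˢ Icc 0 v) := by
    refine UpperSemicontinuousOn.add
      (hρ.1.mono (prod_mono (Icc_subset_Icc_right hq.2) subset_rfl)) ?_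
    have : Continuous fun z : ℝ × ℝ => -(k * max 0 (z.1 - a)) := by fun_prop
    exact this.upperSemicontinuous.upperSemicontinuousOn _
  obtain ⟨z, hz, hmax⟩ := husc.exists_isMaxOn
    ((nonempty_Icc.mpr hq.1).prod (nonempty_Icc.mpr hv)) (isCompact_Icc.prod isCompact_Icc)
  refine ⟨z.1, hz.1, z.2, hz.2, fun x' hx' y' hy' => ?_⟩
  have h := hmax (mk_mem_prod hx' hy')
  rw [mem_ofPred_eq] at h
  linarith

lemma IsPolicy.le_rhoHat {v q p x y : ℝ} {ρ : ℝ → ℝ → ℝ} (hρ : IsPolicy v ρ) (hq : 0 ≤ q)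
    (hx : x ∈ Icc q 1) (hy : y ∈ Icc 0 v) (hxy : x * y ≤ q * p) :
    ρ x y ≤ rhoHat v ρ q p := by
  obtain ⟨B, hB⟩ := hρ.1.bddAbove_of_isCompact (isCompact_Icc.prod isCompact_Icc)
  refine le_csSup ⟨B, ?_⟩ ⟨x, hx, y, hy, hxy, rfl⟩
  rintro _ ⟨x', hx', y', hy', -, rfl⟩
  have hx'' : x' ∈ Icc (0 : ℝ) 1 := ⟨hq.trans hx'.1, hx'.2⟩
  exact hB (mem_image_of_mem _ (mk_mem_prod hx'' hy'))

lemma kcap_nonneg {v α : ℝ} (hv : 0 ≤ v) (hα : α ≤ 1) : 0 ≤ kcap v α :=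
  div_nonneg hv (by linarith)

lemma sub_kcap {v α : ℝ} (hα : α ≤ 1) : v - kcap v α = (1 - α) * kcap v α := by
  have : (2 - α) * kcap v α = v := mul_div_cancel₀ v (by linarith)
  linarith

/-- **Claim 3.** If `ρ̂ (q, p) ≤ ρ̄ qlow + (q - qlow) * k_alpha`, then the
worst-case regret is at least
`(1 - alpha) * (ρ̄ qlow + (q - qlow) * k_alpha) - q * p * log q`. -/
theorem worst_case_regret_underproduction
    (vbar alpha : ℝ) (hv : 0 < vbar) (halpha : alpha ∈ Icc (0:ℝ) 1)
    (ρ : ℝ → ℝ → ℝ) (hρ : IsPolicy vbar ρ)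
    (qlow q p : ℝ) (hqlow : qlow ∈ Icc (0:ℝ) 1) (hq : q ∈ Icc (0:ℝ) 1) (hle : qlow ≤ q)
    (hp : p ∈ Icc (0:ℝ) (kcap vbar alpha))
    (h : rhoHat vbar ρ q p ≤ rhoBar vbar ρ qlow + (q - qlow) * kcap vbar alpha) :
    (((1 - alpha) * (rhoBar vbar ρ qlow + (q - qlow) * kcap vbar alpha)
        - q * p * Real.log q : ℝ) : EReal) ≤ WCR vbar alpha ρ := by
  set k := kcap vbar alpha with hk
  have hk0 : 0 ≤ k := kcap_nonneg hv.le halpha.2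
  have hvk : vbar - k = (1 - alpha) * k := sub_kcap halpha.2
  have hα : 0 ≤ 1 - alpha := sub_nonneg.mpr halpha.2
  have hpv : p ≤ vbar := hp.2.trans (by nlinarith)
  obtain ⟨x, hx, y, hy, hmax⟩ := hρ.exists_max_sub_ramp (a := qlow) (k := k) hv.le hq
  set a := qlow + max 0 (x - qlow) with ha
  have hqa : qlow ≤ a := le_add_of_nonneg_right (le_max_left _ _)
  have hxa : x ≤ a := by linarith [le_max_right 0 (x - qlow)]
  have haq : a ≤ q := by
    have : max 0 (x - qlow) ≤ q - qlow := max_le (sub_nonneg.mpr hle) (by linarith [hx.2])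
    linarith
  have hM : max 0 (x - qlow) = a - qlow := by rw [ha]; ring
  rw [hM] at hmax
  have hbar : rhoBar vbar ρ qlow ≤ ρ x y - k * (a - qlow) := by
    refine csSup_le ⟨ρ 0 0, 0, ⟨le_rfl, hqlow.1⟩, 0, ⟨le_rfl, hv.le⟩, rfl⟩ ?_
    rintro _ ⟨x', hx', y', hy', rfl⟩
    have := hmax x' ⟨hx'.1, hx'.2.trans hle⟩ y' hy'
    rwa [max_eq_left (sub_nonpos.mpr hx'.2), mul_zero, sub_zero] at this
  have hregret := le_RGRT_truncDemand (α := alpha) (y := y) (ρ := ρ) hq hp.1 hpv hk0 hx.1 hxa haq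
  refine le_trans (EReal.coe_le_coe_iff.mpr (le_trans ?_ hregret)) (le_sSup ⟨truncDemand vbar q p,
    rampCost k a q, x, y, isDemand_truncDemand hq.1 hp.1 hpv,
    isCost_rampCost hk0 (hx.1.trans hxa), ⟨⟨⟨hx.1, hx.2.trans hq.2⟩, hy, ?_⟩, ?_⟩, rfl⟩)
  · rw [hvk]
    nlinarith [mul_le_mul_of_nonneg_left hbar hα]
  · simpa only [truncDemand, if_pos hx.2] using hy.2
  · rintro x' y' ⟨hx', hy', hfeas⟩
    have hzero : rampCost k a q x = 0 := by
      rw [rampCost, min_eq_left hx.2, max_eq_left (sub_nonpos.mpr hxa), mul_zero]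
    rw [hzero, sub_zero, rampCost]
    by_cases hxq : x' ≤ q
    · have hm := hmax x' ⟨hx'.1, hxq⟩ y' hy'
      have hramp : max 0 (x' - qlow) ≤ max 0 (x' - a) + (a - qlow) :=
        max_le (add_nonneg (le_max_left _ _) (sub_nonneg.mpr hqa))
          (by linarith [le_max_right 0 (x' - a)])
      rw [min_eq_left hxq]
      nlinarith [mul_le_mul_of_nonneg_left hramp hk0]
    · simp only [truncDemand, if_neg hxq] at hfeas
      push Not at hxq
      rw [le_div_iff₀ (hq.1.trans_lt hxq)] at hfeas
      have hhat := hρ.le_rhoHat hq.1 ⟨hxq.le, hx'.2⟩ hy' ((mul_comm x' y').trans_le hfeas)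
      rw [min_eq_right hxq.le, max_eq_right (sub_nonneg.mpr haq)]
      nlinarith
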